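/- If f has no zeros in the closed interval [0, π], then every real root t of P satisfies |t| > u; moreover, if in addition f(π) > 0, then P has a real root in (−∞, −u), and if in addition f(0) < 0, then P has a real root in (u, ∞). (The case analysis underlying Theorem 8, parts (b) and (c).) -/

import Mathlib

theorem Real.cos_five_mul (θ : ℝ) :
    Real.cos (5 * θ) = 16 * Real.cos θ ^ 5 - 20 * Real.cos θ ^ 3 + 5 * Real.cos θ := by
  rw [show 5 * θ = 2 * θ + 3 * θ by ring, Real.cos_add, Real.cos_two_mul, Real.cos_three_mul,
    Real.sin_two_mul, Real.sin_three_mul]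
  linear_combination (8 * Real.cos θ * (Real.sin θ ^ 2 + 1 - Real.cos θ ^ 2) - 6 * Real.cos θ) *
    Real.sin_sq_add_cos_sq θ

theorem exists_gt_depressed_quintic_pos (m n p q a : ℝ) :
    ∃ x, a < x ∧ 0 < x ^ 5 + m * x ^ 3 + n * x ^ 2 + p * x + q := by
  set x := 1 + |a| + |m| + |n| + |p| + |q| with hx
  have ha := abs_nonneg a
  have hm := abs_nonneg m
  have hn := abs_nonneg n
  have hp := abs_nonneg p
  have hq := abs_nonneg q
  have hx1 : 1 ≤ x := by linarith
  have bound : ∀ c : ℝ, ∀ k ≤ 4, -(|c| * x ^ 4) ≤ c * x ^ k := fun c k hk => by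
    have h1 : x ^ k ≤ x ^ 4 := pow_le_pow_right₀ hx1 hk
    have h2 : 0 ≤ x ^ k := by positivity
    nlinarith [mul_le_mul_of_nonneg_left h1 (abs_nonneg c),
      mul_le_mul_of_nonneg_right (neg_abs_le c) h2]
  refine ⟨x, by linarith [le_abs_self a], ?_⟩
  have hlead : x ^ 5 = (1 + |a|) * x ^ 4 + |m| * x ^ 4 + |n| * x ^ 4 + |p| * x ^ 4
      + |q| * x ^ 4 := by
    rw [pow_succ, mul_comm]
    nth_rewrite 1 [hx]
    ring
  have hpos : 0 < (1 + |a|) * x ^ 4 := by positivity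
  have h3 := bound m 3 (by norm_num)
  have h2 := bound n 2 (by norm_num)
  have h1 := bound p 1 (by norm_num)
  have h0 := bound q 0 (by norm_num)
  rw [pow_one] at h1
  rw [pow_zero, mul_one] at h0
  linarith

theorem exists_root_gt_of_depressed_quintic_neg {m n p q a : ℝ}
    (ha : a ^ 5 + m * a ^ 3 + n * a ^ 2 + p * a + q < 0) :
    ∃ x, a < x ∧ x ^ 5 + m * x ^ 3 + n * x ^ 2 + p * x + q = 0 := by
  obtain ⟨b, hab, hb⟩ := exists_gt_depressed_quintic_pos m n p q a
  have hc : ContinuousOn (fun x : ℝ => x ^ 5 + m * x ^ 3 + n * x ^ 2 + p * x + q)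
      (Set.Icc a b) := by fun_prop
  obtain ⟨x, hx, hx0⟩ := intermediate_value_Ioo hab.le hc ⟨ha, hb⟩
  exact ⟨x, hx.1, hx0⟩


/-- Theorem 8 (b), (c): if f has no zeros in [0, π], all real roots of P satisfy |t| > u;
if moreover f(π) > 0 there is a root in (−∞, −u), and if f(0) < 0 there is a root in (u, ∞). -/
theorem quintic_one_real_root_cases (m n p q : ℝ) (hm : m < 0)
    (P : ℝ → ℝ) (hP : ∀ t, P t = t^5 + m*t^3 + n*t^2 + p*t + q)
    (u : ℝ) (hu : u = 2 * Real.sqrt (-m) / Real.sqrt 5)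
    (α β γ : ℝ) (hα : α = 16*n/u^3) (hβ : β = 16*p/u^4 - 5) (hγ : γ = 16*q/u^5)
    (f : ℝ → ℝ)
    (hf : ∀ θ, f θ = α * Real.cos θ ^ 2 + β * Real.cos θ + Real.cos (5*θ) + γ)
    (hnz : ∀ θ ∈ Set.Icc (0:ℝ) Real.pi, f θ ≠ 0) :
    (∀ t : ℝ, P t = 0 → |t| > u) ∧
    (f Real.pi > 0 → ∃ t ∈ Set.Iio (-u), P t = 0) ∧
    (f 0 < 0 → ∃ t ∈ Set.Ioi u, P t = 0) := by
  have hu0 : 0 < u := by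
    have := Real.sqrt_pos.2 (neg_pos.2 hm)
    rw [hu]
    positivity
  have hu2 : u ^ 2 = -4 * m / 5 := by
    rw [hu, div_pow, mul_pow, Real.sq_sqrt (by linarith), Real.sq_sqrt (by norm_num)]
    ring
  have key : ∀ θ, u ^ 5 * f θ = 16 * P (u * Real.cos θ) := fun θ => by
    have hm' : m = -5 * u ^ 2 / 4 := by linarith
    rw [hf, hP, Real.cos_five_mul, hα, hβ, hγ, hm']
    field_simp
    ring
  refine ⟨fun t ht => ?_, fun hpi => ?_, fun h0 => ?_⟩
  · by_contra! hle
    obtain ⟨hl, hr⟩ := abs_le.1 hle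
    refine hnz (Real.arccos (t / u)) ⟨Real.arccos_nonneg _, Real.arccos_le_pi _⟩ ?_
    have h := key (Real.arccos (t / u))
    rw [Real.cos_arccos (by rw [le_div_iff₀ hu0]; linarith) (by rw [div_le_one hu0]; exact hr),
      mul_div_cancel₀ t hu0.ne', ht, mul_zero] at h
    exact (mul_eq_zero.1 h).resolve_left (by positivity)
  · have hpos : 0 < P (-u) := by
      have h := key Real.pi
      rw [Real.cos_pi, mul_neg_one] at h
      have : 0 < u ^ 5 * f Real.pi := by positivity
      linarith
    rw [hP] at hpos
    obtain ⟨x, hx, hx0⟩ := exists_root_gt_of_depressed_quintic_neg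
      (m := m) (n := -n) (p := p) (q := -q) (a := u) (by linarith)
    refine ⟨-x, neg_lt_neg hx, ?_⟩
    rw [hP]
    linarith
  · have hneg : P u < 0 := by
      have h := key 0
      rw [Real.cos_zero, mul_one] at h
      have := mul_neg_of_pos_of_neg (pow_pos hu0 5) h0
      linarith
    rw [hP] at hneg
    obtain ⟨x, hx, hx0⟩ := exists_root_gt_of_depressed_quintic_neg hneg
    exact ⟨x, hx, by rw [hP, hx0]⟩
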